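/- For every m ≥ 5 and every n ≥ 1, the code A_n of Construction 6 is a complete cyclic m-ary 1-skew-tolerant Gray code of length n: it lists all m^n vectors of (Z/m)^n, cyclically consecutive codewords differ by ±e_i in a single coordinate i, and cyclically consecutive transition positions differ by at most 1. -/

import Mathlib

/-- Codewords `c` and `d` differ exactly at coordinate `i` (1-based), by `±1` there. -/
def TransAt {m : ℕ} (c d : List (ZMod m)) (i : ℕ) : Prop :=
  1 ≤ i ∧ i ≤ c.length ∧ c.length = d.length ∧
  c.take (i-1) = d.take (i-1) ∧ c.drop i = d.drop i ∧
  (d.getD (i-1) 0 = c.getD (i-1) 0 + 1 ∨ d.getD (i-1) 0 = c.getD (i-1) 0 - 1)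

/-- `C` is a cyclic Gray code with transition sequence `δ`. -/
def CyclicGrayWith {m : ℕ} (C : List (List (ZMod m))) (δ : ℕ → ℕ) : Prop :=
  C.Nodup ∧ ∀ i < C.length,
    TransAt (C.getD i []) (C.getD ((i+1) % C.length) []) (δ i)

/-- cyclic `k`-skew-tolerance of a transition sequence. -/
def SkewCyc (P : ℕ) (δ : ℕ → ℕ) (k : ℤ) : Prop :=
  ∀ i < P, |(δ i : ℤ) - (δ ((i+1) % P) : ℤ)| ≤ k


/-- Construction 6: `A_1 = [0;1;…;m−1]`; `A_{n+1}` is `c_n` with last coordinate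
`m−3, m−4, …, 0`, then alternately `A_n'` (for even last coordinate) and `reverse A_n'`
(for odd last coordinate) with last coordinates `0,1,…,m−1`, then `c_n` with last
coordinates `m−1` and `m−2`, where `c_n` is the first codeword of `A_n` and
`A_n'` is `A_n` minus its first codeword. -/
def cm6A (m : ℕ) : ℕ → List (List (ZMod m))
  | 0 => []
  | 1 => (List.range m).map (fun i => [(i : ZMod m)])
  | (n+2) =>
    let P := cm6A m (n+1)
    let c := P.headI
    let P' := P.tail
    ((List.range (m-2)).map (fun t => c ++ [((m - 3 - t : ℕ) : ZMod m)])) ++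
    (((List.range m).map (fun t =>
        (if t % 2 = 0 then P' else P'.reverse).map (· ++ [(Nat.cast t : ZMod m)]))).flatten) ++
    [c ++ [((m-1 : ℕ) : ZMod m)], c ++ [((m-2 : ℕ) : ZMod m)]]

theorem TransAt.symm {m : ℕ} {c d : List (ZMod m)} {i : ℕ} (h : TransAt c d i) :
    TransAt d c i := by
  obtain ⟨h1, h2, h3, h4, h5, h6⟩ := h
  refine ⟨h1, h3 ▸ h2, h3.symm, h4.symm, h5.symm, ?_⟩
  rcases h6 with h6 | h6
  · right; rw [h6, add_sub_cancel_right]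
  · left; rw [h6, sub_add_cancel]

theorem TransAt.append {m : ℕ} {c d : List (ZMod m)} {i : ℕ} (h : TransAt c d i)
    (l : List (ZMod m)) : TransAt (c ++ l) (d ++ l) i := by
  obtain ⟨h1, h2, h3, h4, h5, h6⟩ := h
  refine ⟨h1, by simp; omega, by simp [h3], ?_, ?_, ?_⟩
  · rw [List.take_append_of_le_length (by omega), List.take_append_of_le_length (by omega), h4]
  · rw [List.drop_append_of_le_length (by omega), List.drop_append_of_le_length (by omega), h5]
  · rwa [List.getD_append _ _ _ _ (by omega), List.getD_append _ _ _ _ (by omega)]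

theorem TransAt.append_singleton {m : ℕ} (c : List (ZMod m)) {x y : ZMod m}
    (h : y = x + 1 ∨ y = x - 1) : TransAt (c ++ [x]) (c ++ [y]) (c.length + 1) := by
  refine ⟨by omega, by simp, by simp, by simp, by simp, ?_⟩
  simpa [List.getD_append_right] using h

/-- `SkewPath a b s t l`: the list `l` is a path from `a` to `b` whose transition positions
start with `s`, end with `t`, and change by at most one at each step. -/
inductive SkewPath {m : ℕ} :
    List (ZMod m) → List (ZMod m) → ℕ → ℕ → List (List (ZMod m)) → Prop
  | pair {a b s} : TransAt a b s → SkewPath a b s s [a, b]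
  | glue {a b c : List (ZMod m)} {s t s' t' : ℕ} {l l'} : SkewPath a b s t (l ++ [b]) → |(t : ℤ) - s'| ≤ 1 →
      SkewPath b c s' t' (b :: l') → SkewPath a c s t' (l ++ b :: l')

namespace SkewPath

variable {m : ℕ} {a b c e : List (ZMod m)} {s t s' t' k : ℕ} {l l' : List (List (ZMod m))}

theorem exists_cons (h : SkewPath a b s t l) : ∃ r, l = a :: r := by
  induction h with
  | pair => exact ⟨_, rfl⟩
  | @glue a b c s t s' t' l l' _ _ _ ih _ =>
    obtain ⟨r, hr⟩ := ih
    cases l with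
    | nil => simp_all
    | cons x l => simp_all

theorem reverse (h : SkewPath a b s t l) : SkewPath b a t s l.reverse := by
  induction h with
  | pair h => exact pair h.symm
  | glue _ h _ ih ih' =>
    have := glue (l' := List.reverse _) (by simpa using ih') (by rwa [abs_sub_comm])
      (by simpa using ih)
    simpa using this

theorem exists_concat (h : SkewPath a b s t l) : ∃ r, l = r ++ [b] := by
  obtain ⟨r, hr⟩ := h.reverse.exists_cons
  exact ⟨r.reverse, by simpa using congrArg List.reverse hr⟩

theorem map_append (h : SkewPath a b s t l) (x : List (ZMod m)) :
    SkewPath (a ++ x) (b ++ x) s t (l.map (· ++ x)) := by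
  induction h with
  | pair h => exact pair (h.append x)
  | glue _ h _ ih ih' =>
    have := glue (by simpa using ih) h (by simpa using ih')
    simpa using this

theorem cons (h : TransAt a b k) (hk : |(k : ℤ) - s| ≤ 1) (hl : SkewPath b c s t l) :
    SkewPath a c k t (a :: l) := by
  obtain ⟨r, rfl⟩ := hl.exists_cons
  exact glue (l := [a]) (pair h) hk hl

theorem join (hl : SkewPath a b s t l) (h : TransAt b c k) (htk : |(t : ℤ) - k| ≤ 1)
    (hks : |(k : ℤ) - s'| ≤ 1) (hl' : SkewPath c e s' t' l') :
    SkewPath a e s t' (l ++ l') := by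
  obtain ⟨r, rfl⟩ := hl.exists_concat
  simpa using glue hl htk (cons h hks hl')

theorem exists_transitions (h : SkewPath a b s t l) :
    ∃ δ : ℕ → ℕ, 2 ≤ l.length ∧ l.getD 0 [] = a ∧ l.getD (l.length - 1) [] = b ∧
      δ 0 = s ∧ δ (l.length - 2) = t ∧
      (∀ i, i + 1 < l.length → TransAt (l.getD i []) (l.getD (i + 1) []) (δ i)) ∧
      ∀ i, i + 2 < l.length → |(δ i : ℤ) - δ (i + 1)| ≤ 1 := by
  induction h with
  | @pair a b s h =>
    refine ⟨fun _ => s, by simp, by simp, by simp, rfl, rfl, fun i hi => ?_, by simp⟩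
    obtain rfl : i = 0 := by simpa using hi
    simpa using h
  | @glue a b c s t s' t' l l' _ hts _ ih ih' =>
    obtain ⟨δ, hlen, ha, hb, h0, hlast, htr, hsk⟩ := ih
    obtain ⟨δ', hlen', ha', hb', h0', hlast', htr', hsk'⟩ := ih'
    simp only [List.length_append, List.length_cons, List.length_nil, zero_add] at *
    have left : ∀ i, i ≤ l.length → (l ++ b :: l').getD i [] = (l ++ [b]).getD i [] := by
      intro i hi
      rcases hi.lt_or_eq with h | rfl
      · rw [List.getD_append _ _ _ _ h, List.getD_append _ _ _ _ h]
      · simp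
    have right : ∀ i, l.length ≤ i →
        (l ++ b :: l').getD i [] = (b :: l').getD (i - l.length) [] :=
      fun i hi => List.getD_append_right _ _ _ _ hi
    refine ⟨fun i => if i < l.length then δ i else δ' (i - l.length), by omega, ?_, ?_, ?_, ?_,
      fun i hi => ?_, fun i hi => ?_⟩
    · rw [left _ (by omega), ha]
    · rw [right _ (by omega), ← hb']
      congr 1; omega
    · simpa [show 0 < l.length by omega] using h0
    · simp only [show ¬ (l.length + (l'.length + 1) - 2 < l.length) by omega, if_false, ← hlast']
      congr 1; omega
    · dsimp only
      split_ifs with h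
      · rw [left _ (by omega), left _ (by omega)]
        exact htr i (by omega)
      · rw [right _ (by omega), right _ (by omega), Nat.sub_add_comm (by omega)]
        exact htr' _ (by omega)
    · dsimp only
      rcases lt_trichotomy (i + 1) l.length with h | h | h
      · rw [if_pos (by omega), if_pos h]
        exact hsk i (by omega)
      · rw [if_pos (by omega), if_neg (by omega), h, Nat.sub_self, h0',
          show i = l.length + 1 - 2 by omega, hlast]
        exact hts
      · rw [if_neg (by omega), if_neg (by omega), Nat.sub_add_comm (by omega)]
        exact hsk' _ (by omega)

end SkewPath

/-- A path `p, …, q` closed up by the word `c`, all the transitions at the seam being at `n`. -/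
def SkewLoop {m : ℕ} (n : ℕ) (C : List (List (ZMod m))) : Prop :=
  ∃ c P p q, C = c :: P ∧ c.length = n ∧ SkewPath p q n n P ∧ TransAt c p n ∧ TransAt q c n

theorem SkewLoop.exists_transitions {m n : ℕ} {C : List (List (ZMod m))} (h : SkewLoop n C) :
    ∃ δ : ℕ → ℕ,
      (∀ i < C.length, TransAt (C.getD i []) (C.getD ((i + 1) % C.length) []) (δ i)) ∧
      SkewCyc C.length δ 1 := by
  obtain ⟨c, P, p, q, rfl, -, hP, hcp, hqc⟩ := h
  obtain ⟨δ, hlen, ha, hb, h0, hlast, htr, hsk⟩ :=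
    (SkewPath.cons hcp (by simp) hP).exists_transitions
  set C := c :: P
  refine ⟨fun i => if i = C.length - 1 then n else δ i, fun i hi => ?_, fun i hi => ?_⟩
  · dsimp only
    split_ifs with h
    · rw [h, hb, show C.length - 1 + 1 = C.length by omega, Nat.mod_self, ha]
      exact hqc
    · rw [Nat.mod_eq_of_lt (by omega)]
      exact htr i (by omega)
  · dsimp only
    rcases Nat.lt_or_ge (i + 1) C.length with h | h
    · rw [Nat.mod_eq_of_lt h, if_neg (by omega)]
      split_ifs with h'
      · rw [show i = C.length - 2 by omega, hlast]; simp
      · exact hsk i (by omega)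
    · rw [show i + 1 = C.length by omega, Nat.mod_self, if_pos (by omega), if_neg (by omega), h0]
      simp

section Construction

variable {m : ℕ}

theorem skewPath_column (c : List (ZMod m)) (k : ℕ) :
    SkewPath (c ++ [((k + 1 : ℕ) : ZMod m)]) (c ++ [0]) (c.length + 1) (c.length + 1)
      ((List.range (k + 2)).map fun t => c ++ [((k + 1 - t : ℕ) : ZMod m)]) := by
  induction k with
  | zero =>
    simpa [List.range_succ] using
      SkewPath.pair (TransAt.append_singleton c (x := (1 : ZMod m)) (y := 0) (by simp))
  | succ k ih =>
    rw [List.range_succ_eq_map, List.map_cons, List.map_map]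
    refine SkewPath.cons (TransAt.append_singleton c (y := ((k + 1 : ℕ) : ZMod m))
      (by right; push_cast; ring)) (s := c.length + 1) (by simp) ?_
    convert ih using 4
    simp

theorem skewPath_blocks {P : List (List (ZMod m))} {p q : List (ZMod m)} {n : ℕ}
    (hP : SkewPath p q n n P) (hp : p.length = n) (hq : q.length = n) (k : ℕ) :
    SkewPath (p ++ [0]) ((if k % 2 = 0 then q else p) ++ [(k : ZMod m)]) n n
      ((List.range (k + 1)).map fun t =>
        (if t % 2 = 0 then P else P.reverse).map (· ++ [(Nat.cast t : ZMod m)])).flatten := by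
  induction k with
  | zero => simpa using hP.map_append [0]
  | succ k ih =>
    rw [List.range_succ, List.map_append, List.flatten_append]
    simp only [List.map_cons, List.map_nil, List.flatten_cons, List.flatten_nil, List.append_nil]
    rcases Nat.mod_two_eq_zero_or_one k with h | h
    · have h' : ¬ (k + 1) % 2 = 0 := by omega
      rw [if_pos h] at ih
      rw [if_neg h', if_neg h']
      exact ih.join (TransAt.append_singleton q (by simp)) (by simp [hq]) (by simp [hq])
        (hP.reverse.map_append _)
    · have h' : (k + 1) % 2 = 0 := by omega
      rw [if_neg (by omega)] at ih
      rw [if_pos h', if_pos h']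
      exact ih.join (TransAt.append_singleton p (by simp)) (by simp [hp]) (by simp [hp])
        (hP.map_append _)

theorem skewPath_range (k : ℕ) :
    SkewPath [(1 : ZMod m)] [((k + 2 : ℕ) : ZMod m)] 1 1
      ((List.range (k + 2)).map fun i => [((i + 1 : ℕ) : ZMod m)]) := by
  induction k with
  | zero =>
    have h := SkewPath.pair (TransAt.append_singleton [] (x := (1 : ZMod m)) (y := 2)
      (by left; norm_num))
    simpa [List.range_succ, one_add_one_eq_two] using h
  | succ k ih =>
    rw [List.range_succ, List.map_append]
    have h := (ih.reverse.cons (TransAt.append_singleton []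
      (x := ((k + 1 + 2 : ℕ) : ZMod m)) (y := ((k + 2 : ℕ) : ZMod m))
      (by right; push_cast; ring)) (by simp)).reverse
    have hk : ((k + 1 + 2 : ℕ) : ZMod m) = ((k + 2 + 1 : ℕ) : ZMod m) := by congr 1
    rw [hk] at h ⊢
    simpa using h

theorem cm6A_one : cm6A m 1 = (List.range m).map fun i : ℕ => [(i : ZMod m)] := by
  simp [cm6A, ← List.map_eq_flatMap]

theorem skewLoop_cm6A_one (hm : 5 ≤ m) : SkewLoop 1 (cm6A m 1) := by
  obtain ⟨k, rfl⟩ := Nat.exists_eq_add_of_le hm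
  refine ⟨[0], _, _, _, ?_, rfl, skewPath_range (k + 2),
    TransAt.append_singleton [] (by simp), TransAt.append_singleton [] (Or.inl ?_)⟩
  · rw [cm6A_one, show List.range (5 + k) = List.range (k + 2 + 2 + 1) by rw [add_comm],
      List.range_succ_eq_map]
    simp
  · have h := ZMod.natCast_self (5 + k)
    rw [← h]; push_cast; ring

theorem skewLoop_cm6A_succ (hm : 5 ≤ m) {n : ℕ} (h : SkewLoop (n + 1) (cm6A m (n + 1))) :
    SkewLoop (n + 2) (cm6A m (n + 2)) := by
  obtain ⟨c, P, p, q, hA, hc, hP, hcp, hqc⟩ := h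
  obtain ⟨k, rfl⟩ := Nat.exists_eq_add_of_le hm
  have hp : p.length = n + 1 := by rw [← hcp.2.2.1, hc]
  have hq : q.length = n + 1 := by rw [hqc.2.2.1, hc]
  have col := skewPath_column (m := 5 + k) c k
  have blk := skewPath_blocks hP hp hq (k + 4)
  have tail := SkewPath.pair (TransAt.append_singleton c (x := ((k + 4 : ℕ) : ZMod (5 + k)))
    (y := ((k + 3 : ℕ) : ZMod (5 + k))) (by right; push_cast; ring))
  rw [hc] at col tail
  have seam : TransAt (if (k + 4) % 2 = 0 then q else p) c (n + 1) := by
    split_ifs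
    exacts [hqc, hcp.symm]
  have path := (col.join (hcp.append _) (by simp) (by simp) blk).join (seam.append _)
    (by simp) (by simp) tail
  refine ⟨c ++ [((k + 2 : ℕ) : ZMod (5 + k))], _, _, _, ?_, by simp [hc], path, ?_, ?_⟩
  · rw [cm6A, hA, show 5 + k - 2 = k + 2 + 1 by omega, List.range_succ_eq_map,
      show 5 + k - 3 = k + 2 by omega, show 5 + k - 1 = k + 4 by omega,
      show List.range (5 + k) = List.range (k + 4 + 1) by rw [add_comm]]
    simp only [List.headI, List.tail_cons, List.map_cons, List.map_map, Function.comp_def,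
      Nat.sub_zero, List.cons_append, Nat.succ_eq_add_one,
      show ∀ x, k + 2 - (x + 1) = k + 1 - x by omega, show k + 2 + 1 = k + 3 from rfl]
  · rw [show n + 2 = c.length + 1 by omega]
    exact TransAt.append_singleton c (by right; push_cast; ring)
  · rw [show n + 2 = c.length + 1 by omega]
    exact TransAt.append_singleton c (by right; push_cast; ring)

theorem skewLoop_cm6A (hm : 5 ≤ m) (n : ℕ) : SkewLoop (n + 1) (cm6A m (n + 1)) := by
  induction n with
  | zero => exact skewLoop_cm6A_one hm
  | succ n ih => exact skewLoop_cm6A_succ hm ih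

theorem length_of_mem_cm6A (hm : 5 ≤ m) (n : ℕ) : ∀ w ∈ cm6A m (n + 1), w.length = n + 1 := by
  induction n with
  | zero => simp [cm6A]
  | succ n ih =>
    obtain ⟨c, P, -, -, hA, -⟩ := skewLoop_cm6A hm n
    rw [hA] at ih
    have hc : c.length = n + 1 := ih c (by simp)
    have hP : ∀ w ∈ P, w.length = n + 1 := fun w hw => ih w (by simp [hw])
    intro w hw
    rw [cm6A, hA] at hw
    simp only [List.headI, List.tail_cons, List.mem_append, List.mem_map, List.mem_flatten,
      List.mem_cons, List.not_mem_nil, or_false] at hw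
    rcases hw with (⟨t, -, rfl⟩ | ⟨_, ⟨t, -, rfl⟩, hw⟩) | rfl | rfl
    · simp [hc]
    · obtain ⟨v, hv, rfl⟩ := List.mem_map.1 hw
      have : v ∈ P := by split_ifs at hv <;> simpa using hv
      simp [hP v this]
    · simp [hc]
    · simp [hc]

theorem length_cm6A (hm : 5 ≤ m) (n : ℕ) : (cm6A m (n + 1)).length = m ^ (n + 1) := by
  induction n with
  | zero => simp [cm6A]
  | succ n ih =>
    obtain ⟨c, P, -, -, hA, -⟩ := skewLoop_cm6A hm n
    rw [hA, List.length_cons] at ih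
    have hlen : ∀ t : ℕ, (if t % 2 = 0 then P else P.reverse).length = P.length := by
      intro t; split_ifs <;> simp
    rw [cm6A, hA, pow_succ, ← ih]
    simp only [List.headI, List.tail_cons, List.length_append, List.length_map, List.length_range,
      List.length_flatten, List.map_map, Function.comp_def, hlen, List.length_cons,
      List.length_nil, List.map_const', List.sum_replicate, smul_eq_mul]
    rw [add_mul, mul_comm]
    omega

theorem mem_cm6A (hm : 5 ≤ m) (n : ℕ) :
    ∀ w : List (ZMod m), w.length = n + 1 → w ∈ cm6A m (n + 1) := by
  have : NeZero m := ⟨by omega⟩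
  induction n with
  | zero =>
    intro w hw
    obtain ⟨x, rfl⟩ := List.length_eq_one_iff.1 hw
    rw [cm6A_one]
    exact List.mem_map.2 ⟨x.val, by simpa using x.val_lt, by simp⟩
  | succ n ih =>
    obtain ⟨c, P, -, -, hA, -⟩ := skewLoop_cm6A hm n
    intro w hw
    obtain ⟨v, x, rfl⟩ : ∃ v x, w = v ++ [x] :=
      ⟨w.dropLast, w.getLast (by rintro rfl; simp at hw), (List.dropLast_append_getLast _).symm⟩
    have hv := ih v (by simpa using hw)
    have hx := x.val_lt
    rw [hA, List.mem_cons] at hv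
    rw [cm6A, hA]
    simp only [List.headI, List.tail_cons, List.mem_append, List.mem_map, List.mem_flatten,
      List.mem_cons, List.not_mem_nil, or_false, List.mem_range]
    rcases hv with rfl | hv
    · rcases Nat.lt_or_ge x.val (m - 2) with h | h
      · exact .inl (.inl ⟨m - 3 - x.val, by omega, by
          rw [show m - 3 - (m - 3 - x.val) = x.val by omega, ZMod.natCast_zmod_val]⟩)
      · right
        rcases (show x.val = m - 1 ∨ x.val = m - 2 by omega) with h | h
        · left; rw [← h, ZMod.natCast_zmod_val]
        · right; rw [← h, ZMod.natCast_zmod_val]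
    · refine .inl (.inr ⟨_, ⟨x.val, hx, rfl⟩, List.mem_map.2 ⟨v, ?_, ?_⟩⟩)
      · split_ifs <;> simpa using hv
      · rw [ZMod.natCast_zmod_val]

theorem nodup_cm6A (hm : 5 ≤ m) (n : ℕ) : (cm6A m (n + 1)).Nodup := by
  have : NeZero m := ⟨by omega⟩
  rw [← Multiset.coe_nodup, ← Multiset.toFinset_card_eq_card_iff_nodup]
  refine le_antisymm (Multiset.toFinset_card_le _) ?_
  rw [Multiset.coe_card, length_cm6A hm]
  calc m ^ (n + 1) = (Finset.univ.image (List.Vector.toList (α := ZMod m) (n := n + 1))).card := by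
        rw [Finset.card_image_of_injective _ List.Vector.toList_injective, Finset.card_univ,
          card_vector, ZMod.card]
    _ ≤ _ := Finset.card_le_card fun w hw => by
        obtain ⟨v, -, rfl⟩ := Finset.mem_image.1 hw
        simpa using mem_cm6A hm n _ v.toList_length

end Construction

theorem stmt13 : ∀ m : ℕ, 5 ≤ m → ∀ n : ℕ, 1 ≤ n →
    (∀ c ∈ cm6A m n, c.length = n) ∧ (cm6A m n).length = m ^ n ∧
    (∀ c : List (ZMod m), c.length = n → c ∈ cm6A m n) ∧
    ∃ δ : ℕ → ℕ, CyclicGrayWith (cm6A m n) δ ∧ SkewCyc (cm6A m n).length δ 1 := by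
  intro m hm n hn
  obtain ⟨n, rfl⟩ := Nat.exists_eq_add_of_le' hn
  obtain ⟨δ, htr, hsk⟩ := (skewLoop_cm6A hm n).exists_transitions
  exact ⟨length_of_mem_cm6A hm n, length_cm6A hm n, mem_cm6A hm n,
    δ, ⟨nodup_cm6A hm n, htr⟩, hsk⟩
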